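/- Let β > 1/2. Then there exists ε > 0 such that the triple series Σ 1 / ( ⟨n₂⟩^{2 − 2ε} ⟨n₄⟩^{2 − 2ε} ⟨n₁ + n₂⟩^{2β} ⟨n₁⟩² ⟨n₁ + n₂ + n₄⟩² ) converges, where the sum runs over all (n₁, n₂, n₄) ∈ (ℤ³)³ with ‖n₄‖ ≤ ‖n₂‖. -/

import Mathlib

noncomputable section

/-- Japanese bracket `⟨n⟩ = (1 + ‖n‖²)^{1/2}` of a lattice point `n ∈ ℤ³`. -/
def jb (n : Fin 3 → ℤ) : ℝ :=
  Real.sqrt (1 + ∑ i, ((n i : ℝ)) ^ 2)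

/-- Euclidean norm `‖n‖` of a lattice point `n ∈ ℤ³`. -/
def latNorm (n : Fin 3 → ℤ) : ℝ :=
  Real.sqrt (∑ i, ((n i : ℝ)) ^ 2)

lemma one_le_jb (n : Fin 3 → ℤ) : 1 ≤ jb n :=
  Real.one_le_sqrt.2 (le_add_of_nonneg_right (Finset.sum_nonneg fun _ _ => sq_nonneg _))

lemma jb_pos (n : Fin 3 → ℤ) : 0 < jb n :=
  zero_lt_one.trans_le (one_le_jb n)

lemma jb_sq (n : Fin 3 → ℤ) : jb n ^ 2 = 1 + ∑ i, ((n i : ℝ)) ^ 2 :=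
  Real.sq_sqrt (add_nonneg zero_le_one (Finset.sum_nonneg fun _ _ => sq_nonneg _))

lemma jb_neg (n : Fin 3 → ℤ) : jb (-n) = jb n := by
  simp [jb]

lemma jb_add_sq_le (u v : Fin 3 → ℤ) : jb (u + v) ^ 2 ≤ 2 * (jb u ^ 2 + jb v ^ 2) := by
  simp only [jb_sq, Fin.sum_univ_three, Pi.add_apply, Int.cast_add]
  nlinarith [sq_nonneg ((u 0 : ℝ) - v 0), sq_nonneg ((u 1 : ℝ) - v 1),
    sq_nonneg ((u 2 : ℝ) - v 2)]

lemma summable_sqrt_one_add_sq_rpow {q : ℝ} (hq : 1 < q) :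
    Summable fun k : ℤ => Real.sqrt (1 + (k : ℝ) ^ 2) ^ (-q) := by
  refine Summable.of_norm_bounded_eventually (Real.summable_abs_int_rpow hq) ?_
  filter_upwards [(Set.finite_singleton (0 : ℤ)).compl_mem_cofinite] with k hk
  have hk0 : (k : ℝ) ≠ 0 := by simpa using hk
  rw [Real.norm_of_nonneg (by positivity)]
  refine Real.rpow_le_rpow_of_nonpos (abs_pos.2 hk0) ?_ (by linarith)
  exact Real.abs_le_sqrt (by linarith)

lemma summable_jb_rpow {p : ℝ} (hp : 3 < p) : Summable fun n : Fin 3 → ℤ => jb n ^ (-p) := by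
  have h1 := summable_sqrt_one_add_sq_rpow (q := p / 3) (by linarith)
  have h0 : 0 ≤ fun k : ℤ => Real.sqrt (1 + (k : ℝ) ^ 2) ^ (-(p / 3)) :=
    fun k => by positivity
  have h3 := h1.mul_of_nonneg (h1.mul_of_nonneg h1 h0 h0) h0
    fun x => mul_nonneg (h0 x.1) (h0 x.2)
  have hinj : Function.Injective fun n : Fin 3 → ℤ => (n 0, n 1, n 2) := by
    intro m n h
    simp only [Prod.mk.injEq] at h
    ext i
    fin_cases i
    exacts [h.1, h.2.1, h.2.2]
  refine Summable.of_nonneg_of_le (fun n => Real.rpow_nonneg (jb_pos n).le _) (fun n => ?_)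
    (h3.comp_injective hinj)
  have hc (i : Fin 3) :
      jb n ^ (-(p / 3)) ≤ Real.sqrt (1 + (n i : ℝ) ^ 2) ^ (-(p / 3)) := by
    refine Real.rpow_le_rpow_of_nonpos (by positivity) (Real.sqrt_le_sqrt ?_) (by linarith)
    gcongr
    exact Finset.single_le_sum (f := fun i => (n i : ℝ) ^ 2) (fun _ _ => sq_nonneg _)
      (Finset.mem_univ i)
  have hn := Real.rpow_nonneg (jb_pos n).le (-(p / 3))
  calc jb n ^ (-p)
      = jb n ^ (-(p / 3)) * (jb n ^ (-(p / 3)) * jb n ^ (-(p / 3))) := by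
        rw [← Real.rpow_add (jb_pos n), ← Real.rpow_add (jb_pos n)]
        congr 1
        ring
    _ ≤ _ := mul_le_mul (hc 0) (mul_le_mul (hc 1) (hc 2) hn (h0 _)) (mul_nonneg hn hn) (h0 _)

lemma rpow_neg_mul_rpow_neg_le_of_le {x y z a s t : ℝ} (hx : 0 < x) (hz : 0 < z)
    (hxy : x ≤ y) (hzxy : z ^ 2 ≤ 2 * (x ^ 2 + y ^ 2)) (ha : 0 ≤ a) (hat : a ≤ t) :
    x ^ (-s) * y ^ (-t) ≤ 2 ^ a * z ^ (-a) * x ^ (-(s + t - a)) := by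
  have hy : 0 < y := hx.trans_le hxy
  have hzy : z / 2 ≤ y := by nlinarith
  have h1 : y ^ (-a) ≤ 2 ^ a * z ^ (-a) := by
    calc y ^ (-a) ≤ (z / 2) ^ (-a) :=
          Real.rpow_le_rpow_of_nonpos (by positivity) hzy (by linarith)
      _ = 2 ^ a * z ^ (-a) := by
          rw [Real.div_rpow hz.le zero_le_two, Real.rpow_neg zero_le_two, div_inv_eq_mul, mul_comm]
  have h2 : y ^ (-(t - a)) ≤ x ^ (-(t - a)) :=
    Real.rpow_le_rpow_of_nonpos hx hxy (by linarith)
  calc x ^ (-s) * y ^ (-t) = y ^ (-a) * (x ^ (-s) * y ^ (-(t - a))) := by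
        rw [mul_left_comm, ← Real.rpow_add hy]
        congr 2
        ring
    _ ≤ 2 ^ a * z ^ (-a) * (x ^ (-s) * x ^ (-(t - a))) := by gcongr
    _ = 2 ^ a * z ^ (-a) * x ^ (-(s + t - a)) := by
        rw [← Real.rpow_add hx]
        congr 2
        ring

lemma rpow_neg_mul_rpow_neg_le {x y z a s t : ℝ} (hx : 0 < x) (hy : 0 < y) (hz : 0 < z)
    (hzxy : z ^ 2 ≤ 2 * (x ^ 2 + y ^ 2)) (ha : 0 ≤ a) (has : a ≤ s) (hat : a ≤ t) :
    x ^ (-s) * y ^ (-t) ≤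
      2 ^ a * z ^ (-a) * (x ^ (-(s + t - a)) + y ^ (-(s + t - a))) := by
  rcases le_total x y with h | h
  · refine (rpow_neg_mul_rpow_neg_le_of_le hx hz h hzxy ha hat).trans ?_
    gcongr
    exact le_add_of_nonneg_right (by positivity)
  · have := rpow_neg_mul_rpow_neg_le_of_le (s := t) hy hz h (by linarith) ha has
    rw [mul_comm, add_comm t s] at this
    refine this.trans ?_
    gcongr
    exact le_add_of_nonneg_left (by positivity)

theorem random_kernel_second_moment_sum (β : ℝ) (hβ : 1 / 2 < β) :
    ∃ ε : ℝ, 0 < ε ∧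
      Summable (fun p : {q : (Fin 3 → ℤ) × (Fin 3 → ℤ) × (Fin 3 → ℤ) //
          latNorm q.2.2 ≤ latNorm q.2.1} =>
        1 / (jb p.1.2.1 ^ (2 - 2 * ε) * jb p.1.2.2 ^ (2 - 2 * ε) *
          jb (p.1.1 + p.1.2.1) ^ (2 * β) * jb p.1.1 ^ 2 *
          jb (p.1.1 + p.1.2.1 + p.1.2.2) ^ 2)) := by
  obtain ⟨ε, hε, hε6, hεβ⟩ : ∃ ε : ℝ, 0 < ε ∧ ε ≤ 1 / 6 ∧ ε ≤ (β - 1 / 2) / 6 :=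
    ⟨min (1 / 6) ((β - 1 / 2) / 6), lt_min (by norm_num) (by linarith),
      min_le_left _ _, min_le_right _ _⟩
  refine ⟨ε, hε, ?_⟩
  set a : ℝ := 1 - 3 * ε with ha
  have hP := summable_jb_rpow (p := 3 + ε) (by linarith)
  have hR := summable_jb_rpow (p := 2 * β + 2 * a) (by linarith)
  have h0 (p : ℝ) : 0 ≤ fun n : Fin 3 → ℤ => jb n ^ p :=
    fun n => Real.rpow_nonneg (jb_pos n).le _
  have hF := hR.mul_of_nonneg (hP.mul_of_nonneg hP (h0 _) (h0 _)) (h0 _)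
    fun x => mul_nonneg (h0 _ x.1) (h0 _ x.2)
  let L := Fin 3 → ℤ
  have i1 : Function.Injective fun q : L × L × L => (q.1 + q.2.1, q.2.1, q.2.2) := by
    rintro ⟨u, v, w⟩ ⟨u', v', w'⟩ h
    simp only [Prod.mk.injEq] at h ⊢
    obtain ⟨h1, rfl, rfl⟩ := h
    exact ⟨add_right_cancel h1, rfl, rfl⟩
  have i2 : Function.Injective fun q : L × L × L =>
      (q.1 + q.2.1, q.2.1, q.1 + q.2.1 + q.2.2) := by
    rintro ⟨u, v, w⟩ ⟨u', v', w'⟩ h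
    simp only [Prod.mk.injEq] at h ⊢
    obtain ⟨h1, rfl, h3⟩ := h
    exact ⟨add_right_cancel h1, rfl, add_left_cancel (h1 ▸ h3)⟩
  have i3 : Function.Injective fun q : L × L × L => (q.1 + q.2.1, q.1, q.2.2) := by
    rintro ⟨u, v, w⟩ ⟨u', v', w'⟩ h
    simp only [Prod.mk.injEq] at h ⊢
    obtain ⟨h1, rfl, rfl⟩ := h
    exact ⟨rfl, add_left_cancel h1, rfl⟩
  have i4 : Function.Injective fun q : L × L × L =>
      (q.1 + q.2.1, q.1, q.1 + q.2.1 + q.2.2) := by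
    rintro ⟨u, v, w⟩ ⟨u', v', w'⟩ h
    simp only [Prod.mk.injEq] at h ⊢
    obtain ⟨h1, rfl, h3⟩ := h
    exact ⟨rfl, add_left_cancel h1, add_left_cancel (h1 ▸ h3)⟩
  have hS := ((((hF.comp_injective i1).add (hF.comp_injective i2)).add
    ((hF.comp_injective i3).add (hF.comp_injective i4))).mul_left ((2 : ℝ) ^ a * 2 ^ a)).subtype
      {q : L × L × L | latNorm q.2.2 ≤ latNorm q.2.1}
  refine Summable.of_nonneg_of_le (fun p => ?_) (fun p => ?_) hS
  · have h (p : ℝ) (n) : 0 ≤ jb n ^ p := h0 p n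
    exact one_div_nonneg.2 (mul_nonneg (mul_nonneg (mul_nonneg (mul_nonneg (h _ _) (h _ _)) (h _ _))
      (sq_nonneg _)) (sq_nonneg _))
  obtain ⟨⟨n₁, n₂, n₄⟩, -⟩ := p
  simp only [Function.comp_apply]
  have hm := jb_pos (n₁ + n₂)
  have k1 := rpow_neg_mul_rpow_neg_le (a := a) (s := 2 - 2 * ε) (t := 2) (jb_pos n₂) (jb_pos n₁) hm
    (by linarith [jb_add_sq_le n₁ n₂]) (by linarith) (by linarith) (by linarith)
  have k2 := rpow_neg_mul_rpow_neg_le (a := a) (s := 2 - 2 * ε) (t := 2) (jb_pos n₄)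
    (jb_pos (n₁ + n₂ + n₄)) hm
    (by
      have := jb_add_sq_le (n₁ + n₂ + n₄) (-n₄)
      rw [add_neg_cancel_right, jb_neg] at this
      linarith) (by linarith) (by linarith) (by linarith)
  have he : 2 - 2 * ε + 2 - a = 3 + ε := by rw [ha]; ring
  rw [he] at k1 k2
  have hpos₁ := jb_pos n₁
  have hpos₂ := jb_pos n₂
  have hpos₄ := jb_pos n₄
  have hpos := jb_pos (n₁ + n₂ + n₄)
  have hr : jb (n₁ + n₂) ^ (-(2 * β + 2 * a)) =
      jb (n₁ + n₂) ^ (-(2 * β)) * (jb (n₁ + n₂) ^ (-a) * jb (n₁ + n₂) ^ (-a)) := by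
    rw [← Real.rpow_add hm, ← Real.rpow_add hm]
    congr 1
    ring
  have hterm : 1 / (jb n₂ ^ (2 - 2 * ε) * jb n₄ ^ (2 - 2 * ε) * jb (n₁ + n₂) ^ (2 * β) *
        jb n₁ ^ 2 * jb (n₁ + n₂ + n₄) ^ 2) =
      jb (n₁ + n₂) ^ (-(2 * β)) * ((jb n₂ ^ (-(2 - 2 * ε)) * jb n₁ ^ (-2 : ℝ)) *
        (jb n₄ ^ (-(2 - 2 * ε)) * jb (n₁ + n₂ + n₄) ^ (-2 : ℝ))) := by
    simp only [Real.rpow_neg hpos₁.le, Real.rpow_neg hpos₂.le, Real.rpow_neg hpos₄.le,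
      Real.rpow_neg hpos.le, Real.rpow_neg hm.le, Real.rpow_two, one_div, mul_inv]
    ring
  rw [hterm]
  refine (mul_le_mul_of_nonneg_left (mul_le_mul k1 k2 (by positivity) (by positivity))
    (by positivity)).trans_eq ?_
  simp only [hr]
  ring

end
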